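/- Let a ∈ ℝ with λ_min(A) < a < λ_max(A), and suppose a is not an eigenvalue of A and not an eigenvalue of T. Let step_a : ℝ → ℝ be the function step_a(x) = 1 if x ≥ a and step_a(x) = 0 if x < a. Then ‖step_a(A) b − Q step_a(T) Qᴴ b‖₂ ≤ ( λ_max(A) − a ) · ‖err_k(a)‖₂. -/

import Mathlib

open Matrix MeasureTheory

/-- The Euclidean 2-norm of a complex vector. -/
noncomputable def norm2 {n : ℕ} (v : Fin n → ℂ) : ℝ :=
  Real.sqrt (∑ i, ‖v i‖ ^ 2)

/-- Apply a scalar function to a Hermitian matrix through its spectral decomposition. -/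
noncomputable def matFun {m : ℕ} {B : Matrix (Fin m) (Fin m) ℂ}
    (hB : B.IsHermitian) (f : ℝ → ℂ) : Matrix (Fin m) (Fin m) ℂ :=
  (hB.eigenvectorUnitary : Matrix (Fin m) (Fin m) ℂ) *
    Matrix.diagonal (fun i => f (hB.eigenvalues i)) *
    star (hB.eigenvectorUnitary : Matrix (Fin m) (Fin m) ℂ)

/-- The Lanczos-FA error for the shifted linear system `(A - z I) x = b`. -/
noncomputable def errK {n k : ℕ} (A : Matrix (Fin n) (Fin n) ℂ) (Q : Matrix (Fin n) (Fin k) ℂ)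
    (T : Matrix (Fin k) (Fin k) ℂ) (b : Fin n → ℂ) (z : ℂ) : Fin n → ℂ :=
  (A - z • 1)⁻¹.mulVec b - (Q * (T - z • 1)⁻¹ * Qᴴ).mulVec b

/-- The Lanczos-FA residual for the shifted linear system `(A - z I) x = b`. -/
noncomputable def resK {n k : ℕ} (A : Matrix (Fin n) (Fin n) ℂ) (Q : Matrix (Fin n) (Fin k) ℂ)
    (T : Matrix (Fin k) (Fin k) ℂ) (b : Fin n → ℂ) (z : ℂ) : Fin n → ℂ :=
  b - ((A - z • 1) * (Q * (T - z • 1)⁻¹ * Qᴴ)).mulVec b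

section MatFun

variable {m : ℕ} {B : Matrix (Fin m) (Fin m) ℂ} (hB : B.IsHermitian)

lemma star_eigenvectorUnitary_mul_matFun (f : ℝ → ℂ) :
    star (hB.eigenvectorUnitary : Matrix (Fin m) (Fin m) ℂ) * matFun hB f =
      Matrix.diagonal (fun i => f (hB.eigenvalues i)) *
        star (hB.eigenvectorUnitary : Matrix (Fin m) (Fin m) ℂ) := by
  have hU : star (hB.eigenvectorUnitary : Matrix (Fin m) (Fin m) ℂ) *
      (hB.eigenvectorUnitary : Matrix (Fin m) (Fin m) ℂ) = 1 :=
    Unitary.coe_star_mul_self hB.eigenvectorUnitary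
  rw [matFun, mul_assoc, ← mul_assoc, hU, one_mul]

lemma matFun_mul_matFun (f g : ℝ → ℂ) :
    matFun hB f * matFun hB g = matFun hB (fun x => f x * g x) := by
  rw [matFun, mul_assoc, star_eigenvectorUnitary_mul_matFun, matFun, mul_assoc, ← mul_assoc
    (Matrix.diagonal _), Matrix.diagonal_mul_diagonal, mul_assoc]

lemma matFun_sub_const (z : ℂ) : matFun hB (fun x => (x : ℂ) - z) = B - z • 1 := by
  have hU : (hB.eigenvectorUnitary : Matrix (Fin m) (Fin m) ℂ) *
      star (hB.eigenvectorUnitary : Matrix (Fin m) (Fin m) ℂ) = 1 :=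
    Unitary.coe_mul_star_self hB.eigenvectorUnitary
  have hs : (hB.eigenvectorUnitary : Matrix (Fin m) (Fin m) ℂ) *
      Matrix.diagonal (fun i => (hB.eigenvalues i : ℂ)) *
      star (hB.eigenvectorUnitary : Matrix (Fin m) (Fin m) ℂ) = B := by
    conv_rhs => rw [hB.spectral_theorem, Unitary.conjStarAlgAut_apply]
    rfl
  have hd : Matrix.diagonal (fun i => (hB.eigenvalues i : ℂ) - z) =
      Matrix.diagonal (fun i => (hB.eigenvalues i : ℂ)) - z • 1 := by
    rw [Matrix.smul_one_eq_diagonal, Matrix.diagonal_sub]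
  rw [matFun, hd, mul_sub, sub_mul, hs, mul_smul_comm, mul_one, smul_mul_assoc, hU]

lemma inv_sub_smul_one_eq_matFun (z : ℂ) (hz : ∀ i, (hB.eigenvalues i : ℂ) ≠ z) :
    (B - z • 1)⁻¹ = matFun hB (fun x => ((x : ℂ) - z)⁻¹) := by
  apply Matrix.inv_eq_right_inv
  rw [← matFun_sub_const hB z, matFun_mul_matFun, matFun]
  have : (fun i => ((hB.eigenvalues i : ℂ) - z) * ((hB.eigenvalues i : ℂ) - z)⁻¹) =
      fun _ => 1 := by
    funext i
    exact mul_inv_cancel₀ (sub_ne_zero.2 (hz i))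
  rw [this, Matrix.diagonal_one, mul_one]
  exact Unitary.coe_mul_star_self hB.eigenvectorUnitary

lemma det_sub_smul_one (z : ℂ) : (B - z • 1).det = ∏ i, ((hB.eigenvalues i : ℂ) - z) := by
  rw [← matFun_sub_const hB z, matFun, Matrix.det_mul_right_comm,
    show (hB.eigenvectorUnitary : Matrix (Fin m) (Fin m) ℂ) *
      star (hB.eigenvectorUnitary : Matrix (Fin m) (Fin m) ℂ) = 1 from
    Unitary.coe_mul_star_self hB.eigenvectorUnitary, one_mul, Matrix.det_diagonal]

end MatFun

lemma norm2_sq {n : ℕ} (v : Fin n → ℂ) : ((norm2 v ^ 2 : ℝ) : ℂ) = star v ⬝ᵥ v := by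
  rw [norm2, Real.sq_sqrt (by positivity), dotProduct]
  push_cast
  refine Finset.sum_congr rfl fun i _ => ?_
  rw [Pi.star_apply, RCLike.star_def, Complex.conj_mul']

lemma norm2_nonneg {n : ℕ} (v : Fin n → ℂ) : 0 ≤ norm2 v := Real.sqrt_nonneg _

lemma norm2_ne_zero {n : ℕ} {v : Fin n → ℂ} (hv : v ≠ 0) : norm2 v ≠ 0 := by
  intro h
  apply hv
  rw [norm2, Real.sqrt_eq_zero (by positivity),
    Finset.sum_eq_zero_iff_of_nonneg fun _ _ => by positivity] at h
  funext i
  simpa using h i (Finset.mem_univ i)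

/-- A matrix with orthonormal columns preserves the Euclidean norm. -/
lemma norm2_mulVec {n m : ℕ} (U : Matrix (Fin m) (Fin n) ℂ) (hU : Uᴴ * U = 1)
    (v : Fin n → ℂ) : norm2 (U *ᵥ v) = norm2 v := by
  have h : ((norm2 (U *ᵥ v) ^ 2 : ℝ) : ℂ) = ((norm2 v ^ 2 : ℝ) : ℂ) := by
    rw [norm2_sq, norm2_sq, star_mulVec, ← dotProduct_mulVec, mulVec_mulVec, hU, one_mulVec]
  exact (sq_eq_sq₀ (norm2_nonneg _) (norm2_nonneg _)).1 (Complex.ofReal_injective h)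

lemma norm2_le_mul_norm2 {n : ℕ} {u v : Fin n → ℂ} {r : ℝ} (hr : 0 ≤ r)
    (h : ∀ i, ‖u i‖ ≤ r * ‖v i‖) : norm2 u ≤ r * norm2 v := by
  rw [norm2, norm2, ← Real.sqrt_sq hr, ← Real.sqrt_mul (by positivity), Finset.mul_sum]
  refine Real.sqrt_le_sqrt (Finset.sum_le_sum fun i _ => ?_)
  rw [← mul_pow]
  exact pow_le_pow_left₀ (norm_nonneg _) (h i) 2

/-- The corner entry of the adjugate of a shifted upper Hessenberg matrix does not depend on the
shift. -/
lemma adjugate_upperHessenberg_sub_smul_one {k : ℕ} (hk : 0 < k) (M : Matrix (Fin k) (Fin k) ℂ)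
    (hM : ∀ i j : Fin k, (j : ℕ) + 1 < (i : ℕ) → M i j = 0) (z w : ℂ) :
    (M - z • 1).adjugate ⟨k - 1, Nat.sub_lt hk Nat.one_pos⟩ ⟨0, hk⟩ =
      (M - w • 1).adjugate ⟨k - 1, Nat.sub_lt hk Nat.one_pos⟩ ⟨0, hk⟩ := by
  obtain ⟨m, rfl⟩ : ∃ m, k = m + 1 := ⟨k - 1, by omega⟩
  have hlast : (⟨m + 1 - 1, Nat.sub_lt hk Nat.one_pos⟩ : Fin (m + 1)) = Fin.last m := rfl
  have hzero : (⟨0, hk⟩ : Fin (m + 1)) = 0 := rfl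
  have htri (z : ℂ) : ((M - z • 1).submatrix Fin.succ Fin.castSucc).det =
      ∏ i : Fin m, M i.succ i.castSucc := by
    rw [Matrix.det_of_isUpperTriangular]
    · refine Finset.prod_congr rfl fun i _ => ?_
      simp [Fin.ext_iff]
    · intro i j hij
      have hij' : (j : ℕ) < (i : ℕ) := hij
      have hne : i.succ ≠ j.castSucc := by
        simp only [ne_eq, Fin.ext_iff, Fin.val_succ, Fin.val_castSucc]
        omega
      simp [hne, hM i.succ j.castSucc (by simpa using hij')]
  rw [hlast, hzero, Matrix.adjugate_fin_succ_eq_det_submatrix,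
    Matrix.adjugate_fin_succ_eq_det_submatrix, Fin.succAbove_last, Fin.succAbove_zero, htri, htri]

/-- Coordinates of a Lanczos-FA error in the eigenbasis of `A`. -/
lemma star_eigenvectorUnitary_mulVec_error {n k : ℕ} {A : Matrix (Fin n) (Fin n) ℂ}
    (hA : A.IsHermitian) {M : Matrix (Fin k) (Fin k) ℂ} (hM : M.IsHermitian)
    (Q : Matrix (Fin n) (Fin k) ℂ) (b : Fin n → ℂ) (j : Fin n) :
    ∃ (c : ℂ) (d : Fin k → ℂ), ∀ f : ℝ → ℂ,
      (star (hA.eigenvectorUnitary : Matrix (Fin n) (Fin n) ℂ) *ᵥ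
        (matFun hA f *ᵥ b - (Q * matFun hM f * Qᴴ) *ᵥ b)) j =
      c * f (hA.eigenvalues j) - ∑ i, d i * f (hM.eigenvalues i) := by
  refine ⟨(star (hA.eigenvectorUnitary : Matrix (Fin n) (Fin n) ℂ) *ᵥ b) j,
    fun i => (star (hA.eigenvectorUnitary : Matrix (Fin n) (Fin n) ℂ) * Q *
      (hM.eigenvectorUnitary : Matrix (Fin k) (Fin k) ℂ)) j i *
      (star (hM.eigenvectorUnitary : Matrix (Fin k) (Fin k) ℂ) *ᵥ (Qᴴ *ᵥ b)) i, fun f => ?_⟩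
  rw [mulVec_sub, Pi.sub_apply, mulVec_mulVec, star_eigenvectorUnitary_mul_matFun,
    ← mulVec_mulVec, mulVec_diagonal, mul_comm]
  congr 1
  have h : star (hA.eigenvectorUnitary : Matrix (Fin n) (Fin n) ℂ) *ᵥ
      ((Q * matFun hM f * Qᴴ) *ᵥ b) =
      (star (hA.eigenvectorUnitary : Matrix (Fin n) (Fin n) ℂ) * Q *
      (hM.eigenvectorUnitary : Matrix (Fin k) (Fin k) ℂ)) *ᵥ
      (Matrix.diagonal (fun i => f (hM.eigenvalues i)) *ᵥ
      (star (hM.eigenvectorUnitary : Matrix (Fin k) (Fin k) ℂ) *ᵥ (Qᴴ *ᵥ b))) := by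
    simp only [mulVec_mulVec, matFun, Matrix.mul_assoc]
  rw [h, mulVec, dotProduct]
  refine Finset.sum_congr rfl fun i _ => ?_
  rw [mulVec_diagonal]
  ring

/-- Eigenvalues of a compression `Qᴴ A Q` are at most the largest eigenvalue of `A`. -/
lemma eigenvalues_compression_le {n k : ℕ} {A : Matrix (Fin n) (Fin n) ℂ}
    (hA : A.IsHermitian) {M : Matrix (Fin k) (Fin k) ℂ} (hM : M.IsHermitian)
    (Q : Matrix (Fin n) (Fin k) ℂ) (hQ : Qᴴ * Q = 1) (hQA : Qᴴ * A * Q = M) (i : Fin k) :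
    hM.eigenvalues i ≤ ⨆ j, hA.eigenvalues j := by
  set L := ⨆ j, hA.eigenvalues j
  have hL (j : Fin n) : hA.eigenvalues j ≤ L := le_ciSup (Set.finite_range _).bddAbove j
  set v : Fin k → ℂ := (hM.eigenvectorBasis i).ofLp
  set y : Fin n → ℂ := star (hA.eigenvectorUnitary : Matrix (Fin n) (Fin n) ℂ) *ᵥ (Q *ᵥ v)
  have hv : star v ⬝ᵥ v = 1 := by
    have h := hM.eigenvectorBasis.inner_eq_one i
    rw [EuclideanSpace.inner_eq_star_dotProduct, dotProduct_comm] at h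
    exact h
  have hUU : (hA.eigenvectorUnitary : Matrix (Fin n) (Fin n) ℂ) *
      star (hA.eigenvectorUnitary : Matrix (Fin n) (Fin n) ℂ) = 1 :=
    Unitary.coe_mul_star_self hA.eigenvectorUnitary
  have hy : norm2 y ^ 2 = 1 := by
    rw [norm2_mulVec _ (by rw [← star_eq_conjTranspose, star_star, hUU]), norm2_mulVec _ hQ]
    exact Complex.ofReal_injective (by rw [norm2_sq, hv, Complex.ofReal_one])
  have hA0 : matFun hA (fun x => (x : ℂ)) = A := by
    simpa using matFun_sub_const hA 0
  have hray : (hM.eigenvalues i : ℂ) = ((∑ j, hA.eigenvalues j * ‖y j‖ ^ 2 : ℝ) : ℂ) := by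
    have h1 : (hM.eigenvalues i : ℂ) = star v ⬝ᵥ (M *ᵥ v) := by
      rw [hM.mulVec_eigenvectorBasis i, dotProduct_smul, hv]
      simp
    have h2 : star v ⬝ᵥ (M *ᵥ v) =
        star y ⬝ᵥ (Matrix.diagonal (fun j => (hA.eigenvalues j : ℂ)) *ᵥ y) := by
      rw [← hQA]
      conv_lhs => rw [← hA0, matFun]
      simp only [y, star_mulVec, ← dotProduct_mulVec, mulVec_mulVec,
        star_eq_conjTranspose, conjTranspose_mul, conjTranspose_conjTranspose, Matrix.mul_assoc]
    rw [h1, h2, dotProduct]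
    push_cast
    refine Finset.sum_congr rfl fun j _ => ?_
    rw [mulVec_diagonal, Pi.star_apply, RCLike.star_def, ← Complex.conj_mul']
    ring
  rw [Complex.ofReal_injective hray]
  calc ∑ j, hA.eigenvalues j * ‖y j‖ ^ 2 ≤ ∑ j, L * ‖y j‖ ^ 2 :=
        Finset.sum_le_sum fun j _ => mul_le_mul_of_nonneg_right (hL j) (by positivity)
    _ = L := by
      rw [← Finset.mul_sum, ← Real.sq_sqrt (by positivity : 0 ≤ ∑ j, ‖y j‖ ^ 2)]
      change L * norm2 y ^ 2 = L
      rw [hy, mul_one]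

/-- On the circle centred at `L` through `a < L`, the point `a` is closest to any real `x ≤ L`. -/
lemma abs_sub_le_norm_sub_of_mem_sphere {a L x : ℝ} (hx : x ≤ L) {z : ℂ}
    (hz : z ∈ Metric.sphere (L : ℂ) (L - a)) : ‖(x : ℂ) - a‖ ≤ ‖(x : ℂ) - z‖ := by
  rw [mem_sphere_iff_norm] at hz
  have hxL : ‖(x : ℂ) - L‖ = L - x := by
    rw [← Complex.ofReal_sub, Complex.norm_real, Real.norm_eq_abs, abs_of_nonpos (by linarith)]
    ring
  have h1 := norm_sub_norm_le (z - L) ((x : ℂ) - L)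
  have h2 := norm_sub_norm_le ((x : ℂ) - L) (z - L)
  rw [sub_sub_sub_cancel_right] at h1 h2
  rw [norm_sub_rev z x] at h1
  rw [← Complex.ofReal_sub, Complex.norm_real, Real.norm_eq_abs, abs_le]
  constructor <;> linarith

lemma circleIntegrable_resolvent {a L x : ℝ} (ha : a < L) (hx : x ≤ L) (hxa : x ≠ a) :
    CircleIntegrable (fun z : ℂ => ((x : ℂ) - z)⁻¹) L (L - a) := by
  refine ContinuousOn.circleIntegrable (sub_pos.2 ha).le (ContinuousOn.inv₀ (by fun_prop) ?_)
  intro z hz h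
  have := abs_sub_le_norm_sub_of_mem_sphere hx hz
  rw [h, norm_zero, norm_le_zero_iff, ← Complex.ofReal_sub, Complex.ofReal_eq_zero] at this
  exact hxa (sub_eq_zero.1 this)

lemma circleIntegral_resolvent {a L x : ℝ} (ha : a < L) (hx : x ≤ L) (hxa : x ≠ a) :
    (∮ z in C((L : ℂ), L - a), ((x : ℂ) - z)⁻¹) =
      -(2 * Real.pi * Complex.I) * (if a ≤ x then (1 : ℂ) else 0) := by
  have hxL : ‖(x : ℂ) - L‖ = L - x := by
    rw [← Complex.ofReal_sub, Complex.norm_real, Real.norm_eq_abs, abs_of_nonpos (by linarith)]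
    ring
  by_cases h : a ≤ x
  · have hneg : (fun z : ℂ => ((x : ℂ) - z)⁻¹) = fun z : ℂ => (-1 : ℂ) * (z - (x : ℂ))⁻¹ := by
      funext z
      rw [← neg_sub, inv_neg, neg_one_mul]
    have hball : (x : ℂ) ∈ Metric.ball (L : ℂ) (L - a) := by
      rw [mem_ball_iff_norm, hxL]
      linarith [lt_of_le_of_ne h hxa.symm]
    rw [hneg, circleIntegral.integral_const_mul,
      circleIntegral.integral_sub_inv_of_mem_ball hball, if_pos h]
    ring
  · rw [if_neg h, mul_zero]
    have hne : ∀ z ∈ Metric.closedBall (L : ℂ) (L - a), (x : ℂ) - z ≠ 0 := by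
      intro z hz h0
      rw [mem_closedBall_iff_norm, ← sub_eq_zero.1 h0, hxL] at hz
      exact h (by linarith)
    refine Complex.circleIntegral_eq_zero_of_differentiable_on_off_countable
      (sub_pos.2 ha).le Set.countable_empty (ContinuousOn.inv₀ (by fun_prop) hne) ?_
    intro z hz
    exact DifferentiableAt.inv (by fun_prop) (hne z (Metric.ball_subset_closedBall hz.1))

/-- If a combination of resolvents is dominated on a circle by its value at `a`, the same
combination of step functions is bounded by the radius times this value. -/
lemma norm_step_combination_le {k : ℕ} {a L x : ℝ} {θ : Fin k → ℝ} (ha : a < L) (hx : x ≤ L)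
    (hxa : x ≠ a) (hθ : ∀ i, θ i ≤ L) (hθa : ∀ i, θ i ≠ a) (c : ℂ) (d : Fin k → ℂ) {C : ℝ}
    (hC : ∀ z ∈ Metric.sphere (L : ℂ) (L - a),
      ‖c * ((x : ℂ) - z)⁻¹ - ∑ i, d i * ((θ i : ℂ) - z)⁻¹‖ ≤ C) :
    ‖c * (if a ≤ x then (1 : ℂ) else 0) - ∑ i, d i * (if a ≤ θ i then (1 : ℂ) else 0)‖ ≤
      (L - a) * C := by
  have hint (i : Fin k) :
      CircleIntegrable (fun z : ℂ => d i * ((θ i : ℂ) - z)⁻¹) L (L - a) :=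
    (circleIntegrable_resolvent ha (hθ i) (hθa i)).const_smul
  have hfst : CircleIntegrable (fun z : ℂ => c * ((x : ℂ) - z)⁻¹) L (L - a) :=
    (circleIntegrable_resolvent ha hx hxa).const_smul
  have hsum : CircleIntegrable (fun z : ℂ => ∑ i, d i * ((θ i : ℂ) - z)⁻¹) L (L - a) :=
    CircleIntegrable.fun_sum _ fun i _ => hint i
  have hmain := circleIntegral.norm_two_pi_i_inv_smul_integral_le_of_norm_le_const
    (sub_pos.2 ha).le hC
  rw [circleIntegral.integral_sub hfst hsum,
    circleIntegral.integral_fun_sum fun i _ => hint i] at hmain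
  simp only [circleIntegral.integral_const_mul] at hmain
  rw [circleIntegral_resolvent ha hx hxa] at hmain
  simp only [circleIntegral_resolvent ha (hθ _) (hθa _)] at hmain
  convert hmain using 1
  rw [← norm_neg]
  congr 1
  have hpi : (2 * Real.pi * Complex.I : ℂ) ≠ 0 := Complex.two_pi_I_ne_zero
  rw [smul_eq_mul, eq_inv_mul_iff_mul_eq₀ hpi, neg_sub, mul_sub, Finset.mul_sum, sub_eq_neg_add,
    sub_eq_add_neg, ← Finset.sum_neg_distrib]
  congr 1
  · ring
  · exact Finset.sum_congr rfl fun i _ => by ring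

/-- The residual of the Lanczos-FA approximation to a shifted system is a multiple of the last
Lanczos vector. -/
lemma sub_smul_one_mulVec_errK {n k : ℕ} {A : Matrix (Fin n) (Fin n) ℂ}
    {Q : Matrix (Fin n) (Fin k) ℂ} {M : Matrix (Fin k) (Fin k) ℂ} {b q : Fin n → ℂ} {β : ℂ}
    {s l : Fin k} {ν : ℂ} (hQ : Qᴴ * Q = 1) (hb : b = ν • (Q *ᵥ Pi.single s 1))
    (hAQ : A * Q = Q * M + β • Matrix.vecMulVec q (Pi.single l 1)) {z : ℂ}
    (hAz : IsUnit (A - z • 1).det) (hMz : IsUnit (M - z • 1).det) :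
    (A - z • 1) *ᵥ errK A Q M b z = -(β * ν * (M - z • 1)⁻¹ l s) • q := by
  have hQb : Qᴴ *ᵥ b = ν • Pi.single s 1 := by
    rw [hb, mulVec_smul, mulVec_mulVec, hQ, one_mulVec]
  have hAQz : (A - z • 1) * Q = Q * (M - z • 1) + β • Matrix.vecMulVec q (Pi.single l 1) := by
    rw [Matrix.sub_mul, hAQ, Matrix.mul_sub, Matrix.smul_mul, Matrix.one_mul, Matrix.mul_smul,
      Matrix.mul_one]
    abel
  have happ : (A - z • 1) *ᵥ ((Q * (M - z • 1)⁻¹ * Qᴴ) *ᵥ b) =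
      b + (β * ν * (M - z • 1)⁻¹ l s) • q := by
    rw [← mulVec_mulVec, hQb, mulVec_mulVec, ← Matrix.mul_assoc, hAQz, Matrix.add_mul,
      Matrix.mul_assoc, Matrix.mul_nonsing_inv _ hMz, Matrix.mul_one, add_mulVec, mulVec_smul,
      ← hb, Matrix.smul_mul, smul_mulVec, ← mulVec_mulVec, mulVec_smul, mulVec_smul, vecMulVec_mulVec]
    simp only [mulVec_single_one, single_one_dotProduct, col_apply]
    simp [smul_smul, mul_assoc]
  rw [errK, mulVec_sub, happ, mulVec_mulVec, Matrix.mul_nonsing_inv _ hAz, one_mulVec, neg_smul]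
  abel

/-- Lanczos-FA step function bound for a Hermitian upper Hessenberg projected matrix. -/
lemma norm2_step_error_le {n k : ℕ} (hk : 0 < k) {A : Matrix (Fin n) (Fin n) ℂ}
    (hA : A.IsHermitian) {b q : Fin n → ℂ} (hb : b ≠ 0) {Q : Matrix (Fin n) (Fin k) ℂ}
    (hQ : Qᴴ * Q = 1)
    (hQb : Q.mulVec (Pi.single (⟨0, hk⟩ : Fin k) 1) = (norm2 b)⁻¹ • b)
    {M : Matrix (Fin k) (Fin k) ℂ} (hM : ∀ i j : Fin k, (j : ℕ) + 1 < (i : ℕ) → M i j = 0)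
    {β : ℂ} (hQq : Qᴴ.mulVec q = 0)
    (hAQ : A * Q = Q * M + β •
      Matrix.vecMulVec q (Pi.single (⟨k - 1, Nat.sub_lt hk Nat.one_pos⟩ : Fin k) 1))
    (hMH : M.IsHermitian) {a : ℝ} (ha : a < ⨆ i, hA.eigenvalues i)
    (haA : ∀ i, hA.eigenvalues i ≠ a) (haM : ∀ i, hMH.eigenvalues i ≠ a) :
    norm2 ((matFun hA fun x : ℝ => if a ≤ x then (1 : ℂ) else 0).mulVec b -
        (Q * matFun hMH (fun x : ℝ => if a ≤ x then (1 : ℂ) else 0) * Qᴴ).mulVec b) ≤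
      ((⨆ i, hA.eigenvalues i) - a) * norm2 (errK A Q M b (a : ℂ)) := by
  set L := ⨆ i, hA.eigenvalues i
  have hAL (j : Fin n) : hA.eigenvalues j ≤ L := le_ciSup (Set.finite_range _).bddAbove j
  have hQA : Qᴴ * A * Q = M := by
    rw [Matrix.mul_assoc, hAQ, Matrix.mul_add, ← Matrix.mul_assoc, hQ, Matrix.one_mul,
      Matrix.mul_smul, Matrix.mul_vecMulVec, hQq]
    simp
  have hML := eigenvalues_compression_le hA hMH Q hQ hQA
  have hb' : b = (norm2 b : ℂ) • (Q *ᵥ Pi.single (⟨0, hk⟩ : Fin k) 1) := by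
    rw [hQb, Complex.coe_smul, smul_inv_smul₀ (norm2_ne_zero hb)]
  have hr : 0 ≤ L - a := (sub_pos.2 ha).le
  have hUU : (star (hA.eigenvectorUnitary : Matrix (Fin n) (Fin n) ℂ))ᴴ *
      star (hA.eigenvectorUnitary : Matrix (Fin n) (Fin n) ℂ) = 1 := by
    rw [← star_eq_conjTranspose, star_star]
    exact Unitary.coe_mul_star_self hA.eigenvectorUnitary
  have hdist {x : ℝ} (hx : x ≤ L) {z : ℂ} (hz : z ∈ Metric.sphere (L : ℂ) (L - a)) :=
    abs_sub_le_norm_sub_of_mem_sphere hx hz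
  have hne {x : ℝ} (hx : x ≤ L) (hxa : x ≠ a) {z : ℂ}
      (hz : z ∈ Metric.sphere (L : ℂ) (L - a)) : (x : ℂ) ≠ z := by
    have hpos : 0 < ‖(x : ℂ) - a‖ :=
      norm_pos_iff.2 (sub_ne_zero.2 (Complex.ofReal_injective.ne hxa))
    exact sub_ne_zero.1 (norm_pos_iff.1 (hpos.trans_le (hdist hx hz)))
  have haS : (a : ℂ) ∈ Metric.sphere (L : ℂ) (L - a) := by
    rw [mem_sphere_iff_norm, ← Complex.ofReal_sub, Complex.norm_real, Real.norm_eq_abs,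
      abs_sub_comm, abs_of_nonneg hr]
  rw [← norm2_mulVec _ hUU, ← norm2_mulVec _ hUU (errK A Q M b a)]
  refine norm2_le_mul_norm2 hr fun j => ?_
  obtain ⟨c, d, hcd⟩ := star_eigenvectorUnitary_mulVec_error hA hMH Q b j
  have herr {z : ℂ} (hz : z ∈ Metric.sphere (L : ℂ) (L - a)) :
      (star (hA.eigenvectorUnitary : Matrix (Fin n) (Fin n) ℂ) *ᵥ errK A Q M b z) j =
        c * ((hA.eigenvalues j : ℂ) - z)⁻¹ - ∑ i, d i * ((hMH.eigenvalues i : ℂ) - z)⁻¹ := by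
    rw [errK, inv_sub_smul_one_eq_matFun hA z fun i => hne (hAL i) (haA i) hz,
      inv_sub_smul_one_eq_matFun hMH z fun i => hne (hML i) (haM i) hz, hcd]
  obtain ⟨γ, hγ⟩ : ∃ γ : ℂ, ∀ z ∈ Metric.sphere (L : ℂ) (L - a),
      (star (hA.eigenvectorUnitary : Matrix (Fin n) (Fin n) ℂ) *ᵥ errK A Q M b z) j =
        γ / (((hA.eigenvalues j : ℂ) - z) * ∏ i, ((hMH.eigenvalues i : ℂ) - z)) := by
    refine ⟨-(β * norm2 b *
      (M - (0 : ℂ) • 1).adjugate ⟨k - 1, Nat.sub_lt hk Nat.one_pos⟩ ⟨0, hk⟩) *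
      (star (hA.eigenvectorUnitary : Matrix (Fin n) (Fin n) ℂ) *ᵥ q) j, fun z hz => ?_⟩
    have hAz : (hA.eigenvalues j : ℂ) - z ≠ 0 := sub_ne_zero.2 (hne (hAL j) (haA j) hz)
    have hMz : ∏ i, ((hMH.eigenvalues i : ℂ) - z) ≠ 0 :=
      Finset.prod_ne_zero_iff.2 fun i _ => sub_ne_zero.2 (hne (hML i) (haM i) hz)
    have hAu : IsUnit (A - z • 1).det := by
      rw [det_sub_smul_one hA, isUnit_iff_ne_zero]
      exact Finset.prod_ne_zero_iff.2 fun i _ => sub_ne_zero.2 (hne (hAL i) (haA i) hz)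
    have hMu : IsUnit (M - z • 1).det := by
      rw [det_sub_smul_one hMH, isUnit_iff_ne_zero]
      exact hMz
    have hres := congrArg
      (fun v => (star (hA.eigenvectorUnitary : Matrix (Fin n) (Fin n) ℂ) *ᵥ v) j)
      (sub_smul_one_mulVec_errK hQ hb' hAQ hAu hMu)
    have hadj := adjugate_upperHessenberg_sub_smul_one hk M hM z 0
    simp only [← matFun_sub_const hA z, mulVec_mulVec, star_eigenvectorUnitary_mul_matFun] at hres
    rw [← mulVec_mulVec, mulVec_diagonal, mulVec_smul, Pi.smul_apply, smul_eq_mul,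
      Matrix.inv_def, Ring.inverse_eq_inv', Matrix.smul_apply, hadj, smul_eq_mul,
      det_sub_smul_one hMH] at hres
    rw [eq_div_iff (mul_ne_zero hAz hMz), ← mul_assoc, mul_comm _ ((hA.eigenvalues j : ℂ) - z),
      hres]
    field_simp
  rw [hcd]
  refine norm_step_combination_le ha (hAL j) (haA j) hML haM c d fun z hz => ?_
  rw [← herr hz, hγ z hz, hγ a haS, norm_div, norm_div, norm_mul, norm_mul, norm_prod, norm_prod]
  have hpos {x : ℝ} (hx : x ≤ L) (hxa : x ≠ a) : 0 < ‖(x : ℂ) - a‖ :=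
    norm_pos_iff.2 (sub_ne_zero.2 (hne hx hxa haS))
  refine div_le_div_of_nonneg_left (norm_nonneg _)
    (mul_pos (hpos (hAL j) (haA j)) (Finset.prod_pos fun i _ => hpos (hML i) (haM i))) ?_
  exact mul_le_mul (hdist (hAL j) hz)
    (Finset.prod_le_prod (fun _ _ => norm_nonneg _) fun i _ => hdist (hML i) hz)
    (Finset.prod_nonneg fun _ _ => norm_nonneg _) (norm_nonneg _)

theorem lanczos_fa_step_bound
    {n k : ℕ} (hn : 0 < n) (hk : 0 < k)
    (A : Matrix (Fin n) (Fin n) ℂ) (hA : A.IsHermitian)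
    (b : Fin n → ℂ) (hb : b ≠ 0)
    (Q : Matrix (Fin n) (Fin k) ℂ) (hQ : Qᴴ * Q = 1)
    (hQb : Q.mulVec (Pi.single (⟨0, hk⟩ : Fin k) 1) = (norm2 b)⁻¹ • b)
    (T : Matrix (Fin k) (Fin k) ℝ) (hTsymm : T.IsSymm)
    (hTtri : ∀ i j : Fin k, (i : ℕ) + 1 < (j : ℕ) ∨ (j : ℕ) + 1 < (i : ℕ) → T i j = 0)
    (hToff : ∀ i j : Fin k, (i : ℕ) + 1 = (j : ℕ) → 0 < T i j)
    (βk : ℝ) (hβk : 0 < βk)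
    (q : Fin n → ℂ) (hq : norm2 q = 1) (hQq : Qᴴ.mulVec q = 0)
    (hAQ : A * Q = Q * T.map Complex.ofReal + (βk : ℂ) •
      Matrix.vecMulVec q (Pi.single (⟨k - 1, Nat.sub_lt hk Nat.one_pos⟩ : Fin k) 1))
    (hTH : (T.map Complex.ofReal).IsHermitian)
    (a : ℝ) (ha₁ : (⨅ i, hA.eigenvalues i) < a) (ha₂ : a < ⨆ i, hA.eigenvalues i)
    (haA : ∀ i, hA.eigenvalues i ≠ a) (haT : ∀ i, hTH.eigenvalues i ≠ a) :
    norm2 ((matFun hA fun x : ℝ => if a ≤ x then (1 : ℂ) else 0).mulVec b -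
        (Q * matFun hTH (fun x : ℝ => if a ≤ x then (1 : ℂ) else 0) * Qᴴ).mulVec b) ≤
      ((⨆ i, hA.eigenvalues i) - a) * norm2 (errK A Q (T.map Complex.ofReal) b (a : ℂ)) := by
  exact norm2_step_error_le hk hA hb hQ hQb
    (fun i j hij => by simp [hTtri i j (Or.inr hij)]) hQq hAQ hTH ha₂ haA haT
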